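/- Let p ≥ 1, {c_n} be a sequence of positive numbers, and {X_{n,j}, 1 ≤ j ≤ k_n, n ≥ 1} be an array of random variables satisfying the exponential-type maximal inequality (2.1) with nonnegative sequences {α_n}, {β_n}. Suppose there exists δ > 0 such that: (a) for any λ > 0, ∑_{n=1}^∞ c_n P{max_{1≤i≤k_n} |∑_{j=1}^i (X_{n,j} − E[X_{n,j} 1_{{|X_{n,j}| ≤ δ}}])| > λ} < ∞; (b) max_{1≤j≤k_n} P{|X_{n,j}| > δ} = o(1) and ∑_{j=1}^{k_n} P{|X_{n,j}| > δ} = O(1) as n → ∞; (c) ∑_{n=1}^∞ ∑_{j=1}^{k_n} c_n (1 + α_n) ∫_{δ^p}^∞ P{|X_{n,j}|^p > t} dt < ∞; (d) for some q > p, ∑_{n=1}^∞ c_n β_n ∫_{δ^p}^∞ (∑_{j=1}^{k_n} P{|X_{n,j}|^p > t})^q dt < ∞, ∑_{n=1}^∞ c_n β_n (∑_{j=1}^{k_n} Var(X_{n,j} 1_{{|X_{n,j}| ≤ δ}}))^q < ∞, and ∑_{n=1}^∞ c_n β_n (∑_{j=1}^{k_n} E[|X_{n,j}| 1_{{|X_{n,j}|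 > δ}}])^q < ∞. Then for all ε > 0, ∑_{n=1}^∞ c_n E[(max_{1≤i≤k_n} |∑_{j=1}^i (X_{n,j} − E[X_{n,j} 1_{{|X_{n,j}| ≤ δ}}])| − ε)_+^p] < ∞. -/

import Mathlib

open MeasureTheory Finset

/-- Truncation at level `ℓ`: `g_ℓ(x) = (x ∧ ℓ) ∨ (-ℓ)`. -/
noncomputable def truncAt (l x : ℝ) : ℝ := max (min x l) (-l)

/-- The exponential-type maximal inequality (2.1) for the array `X` with row lengths `k`
and nonnegative sequences `α`, `β`: there are constants `C₁, C₂ > 0`, not depending on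
`n, ℓ, λ, η`, such that for every `n ≥ 1` and all `ℓ, λ, η > 0`,
`P{max_{1≤i≤kₙ} |∑_{j=1}^i [g_ℓ(X_{n,j}) − E g_ℓ(X_{n,j})]| ≥ λ}
  ≤ αₙ P{max_{1≤j≤kₙ} |g_ℓ(X_{n,j}) − E g_ℓ(X_{n,j})| > C₁ η}
    + βₙ (∑_{j=1}^{kₙ} E (g_ℓ(X_{n,j}) − E g_ℓ(X_{n,j}))² / (C₂ λ η))^{λ/η}`. -/
def ExpMaxIneq {Ω : Type*} [MeasurableSpace Ω] (μ : Measure Ω)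
    (k : ℕ → ℕ) (X : ℕ → ℕ → Ω → ℝ) (α β : ℕ → ℝ) : Prop :=
  ∃ C₁ > (0 : ℝ), ∃ C₂ > (0 : ℝ), ∀ n, 1 ≤ n → ∀ l > (0 : ℝ), ∀ lam > (0 : ℝ), ∀ η > (0 : ℝ),
    μ {ω | ∃ i ∈ Finset.Icc 1 (k n), lam ≤
        |∑ j ∈ Finset.Icc 1 i, (truncAt l (X n j ω) - ∫ ω', truncAt l (X n j ω') ∂μ)|}
      ≤ ENNReal.ofReal (α n) *
          μ {ω | ∃ j ∈ Finset.Icc 1 (k n),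
            C₁ * η < |truncAt l (X n j ω) - ∫ ω', truncAt l (X n j ω') ∂μ|}
        + ENNReal.ofReal (β n) *
          ENNReal.ofReal ((∑ j ∈ Finset.Icc 1 (k n),
              ∫ ω', (truncAt l (X n j ω') - ∫ ω'', truncAt l (X n j ω'') ∂μ) ^ 2 ∂μ) /
            (C₂ * lam * η)) ^ (lam / η)

lemma abs_truncAt_le {l : ℝ} (hl : 0 ≤ l) (x : ℝ) : |truncAt l x| ≤ l := by
  unfold truncAt
  exact abs_le.2 ⟨le_max_right _ _, max_le (min_le_right _ _) (by linarith)⟩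

lemma truncAt_of_abs_le {l x : ℝ} (h : |x| ≤ l) : truncAt l x = x := by
  unfold truncAt
  rw [min_eq_left (abs_le.1 h).2, max_eq_left (abs_le.1 h).1]

lemma abs_truncAt_le_abs {l : ℝ} (hl : 0 ≤ l) (x : ℝ) : |truncAt l x| ≤ |x| := by
  by_cases h : |x| ≤ l
  · rw [truncAt_of_abs_le h]
  · exact (abs_truncAt_le hl x).trans (not_le.1 h).le

lemma measurable_truncAt (l : ℝ) : Measurable (truncAt l) := by
  unfold truncAt
  fun_prop

lemma antitone_measure_lt_abs_rpow {Ω : Type*} [MeasurableSpace Ω] {μ : Measure Ω}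
    (f : Ω → ℝ) (p : ℝ) :
    Antitone fun t : ℝ => μ {ω | t < |f ω| ^ p} :=
  fun _ _ hst => measure_mono fun _ hω => lt_of_le_of_lt hst hω

lemma lintegral_rpow_sub_le {Ω : Type*} [MeasurableSpace Ω] {μ : Measure Ω}
    {f : Ω → ℝ} (hf : Measurable f) {p ε T : ℝ} (hp : 0 < p)
    (hε : 0 < ε) (hT : 0 ≤ T) :
    ∫⁻ ω, ENNReal.ofReal (f ω - ε) ^ p ∂μ
      ≤ ENNReal.ofReal T * μ {ω | ε < f ω} + ∫⁻ t in Set.Ioi T, μ {ω | t ^ p⁻¹ < f ω} := by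
  have h1 : ∀ ω, ENNReal.ofReal (f ω - ε) ^ p = ENNReal.ofReal ((max (f ω - ε) 0) ^ p) := by
    intro ω
    rw [← ENNReal.ofReal_rpow_of_nonneg (le_max_right _ _) hp.le, ENNReal.ofReal_max,
      ENNReal.ofReal_zero, max_eq_left zero_le]
  have hlt : ∀ t, 0 ≤ t → ∀ ω, t < (max (f ω - ε) 0) ^ p → t ^ p⁻¹ < f ω - ε := by
    intro t ht ω h
    have h2 := (Real.rpow_inv_lt_iff_of_pos ht (le_max_right _ _) hp).2 h
    exact (lt_max_iff.1 h2).resolve_right (Real.rpow_nonneg ht _).not_gt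
  simp_rw [h1]
  rw [lintegral_eq_lintegral_meas_lt μ
    (Filter.Eventually.of_forall fun ω => Real.rpow_nonneg (le_max_right _ _) _) (by fun_prop),
    ← Set.Ioc_union_Ioi_eq_Ioi hT, lintegral_union measurableSet_Ioi
      (Set.Ioc_disjoint_Ioi le_rfl)]
  refine add_le_add ?_ (setLIntegral_mono' measurableSet_Ioi fun t ht =>
    measure_mono fun ω hω => ?_)
  · calc _ ≤ ∫⁻ _ in Set.Ioc 0 T, μ {ω | ε < f ω} :=
          setLIntegral_mono' measurableSet_Ioc fun t ht => measure_mono fun ω hω =>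
            sub_pos.1 ((Real.rpow_nonneg ht.1.le _).trans_lt (hlt t ht.1.le ω hω))
      _ = _ := by simp [mul_comm]
  · exact (hlt t (hT.trans (Set.mem_Ioi.1 ht).le) ω hω).trans (sub_lt_self _ hε)

lemma lintegral_Ioi_comp_mul_left (f : ℝ → ENNReal) {r : ℝ} (hr : 0 < r) (T : ℝ) :
    ENNReal.ofReal r * ∫⁻ t in Set.Ioi T, f (r * t) = ∫⁻ t in Set.Ioi (r * T), f t := by
  conv_rhs => rw [← lintegral_indicator measurableSet_Ioi,
    ← Real.smul_map_volume_mul_left hr.ne', abs_of_pos hr]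
  have he : MeasurableEmbedding fun x : ℝ => r * x :=
    (MeasurableEquiv.mulLeft₀ r hr.ne').measurableEmbedding
  rw [lintegral_smul_measure, he.lintegral_map, ← lintegral_indicator measurableSet_Ioi,
    smul_eq_mul]
  congr 2 with t
  simp [Set.indicator_apply, mul_lt_mul_iff_right₀ hr]

section Row

variable {Ω : Type*} [MeasurableSpace Ω] {μ : Measure Ω} [IsProbabilityMeasure μ]

lemma measurable_ite_abs_le {f : Ω → ℝ} (hf : Measurable f) (δ : ℝ) :
    Measurable fun ω => if |f ω| ≤ δ then f ω else 0 :=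
  Measurable.ite (measurableSet_le (by fun_prop) measurable_const) hf measurable_const

lemma abs_ite_abs_le {δ : ℝ} (hδ : 0 ≤ δ) (x : ℝ) : |if |x| ≤ δ then x else 0| ≤ δ := by
  split_ifs with h
  · exact h
  · simpa using hδ

lemma abs_truncAt_sub_ite_le {δ l : ℝ} (hδ : 0 ≤ δ) (hl : δ ≤ l) (x : ℝ) :
    |truncAt l x - if |x| ≤ δ then x else 0| ≤ if δ < |x| then l else 0 := by
  by_cases h : |x| ≤ δ
  · rw [if_pos h, if_neg h.not_gt, truncAt_of_abs_le (h.trans hl)]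
    simp
  · rw [if_neg h, if_pos (not_le.1 h), sub_zero]
    exact abs_truncAt_le (hδ.trans hl) x

lemma sq_truncAt_sub_ite_le {δ l : ℝ} (hδ : 0 ≤ δ) (hl : δ ≤ l) (x : ℝ) :
    (truncAt l x - if |x| ≤ δ then x else 0) ^ 2 ≤ l * if δ < |x| then |x| else 0 := by
  by_cases h : |x| ≤ δ
  · rw [if_pos h, if_neg h.not_gt, truncAt_of_abs_le (h.trans hl)]
    simp
  · rw [if_neg h, if_pos (not_le.1 h), sub_zero, ← sq_abs, sq]
    exact mul_le_mul (abs_truncAt_le (hδ.trans hl) x) (abs_truncAt_le_abs (hδ.trans hl) x)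
      (abs_nonneg _) (hδ.trans hl)

lemma integrable_truncAt {f : Ω → ℝ} (hf : Measurable f) {l : ℝ} (hl : 0 ≤ l) :
    Integrable (fun ω => truncAt l (f ω)) μ :=
  Integrable.of_bound ((measurable_truncAt l).comp hf).aestronglyMeasurable l
    (Filter.Eventually.of_forall fun ω => abs_truncAt_le hl (f ω))

lemma integrable_ite_abs_le {f : Ω → ℝ} (hf : Measurable f) {δ : ℝ} (hδ : 0 ≤ δ) :
    Integrable (fun ω => if |f ω| ≤ δ then f ω else 0) μ :=
  Integrable.of_bound (measurable_ite_abs_le hf δ).aestronglyMeasurable δ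
    (Filter.Eventually.of_forall fun ω => abs_ite_abs_le hδ (f ω))

lemma abs_integral_truncAt_le {f : Ω → ℝ} {l : ℝ} (hl : 0 ≤ l) :
    |∫ ω, truncAt l (f ω) ∂μ| ≤ l := by
  have := norm_integral_le_of_norm_le_const (μ := μ) (f := fun ω => truncAt l (f ω)) (C := l)
    (Filter.Eventually.of_forall fun ω => abs_truncAt_le hl (f ω))
  simpa using this

lemma abs_integral_truncAt_sub_le {f : Ω → ℝ} (hf : Measurable f) {δ l : ℝ}
    (hδ : 0 ≤ δ) (hl : δ ≤ l) :
    |∫ ω, truncAt l (f ω) ∂μ - ∫ ω, (if |f ω| ≤ δ then f ω else 0) ∂μ|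
      ≤ l * (μ {ω | δ < |f ω|}).toReal := by
  have hms : MeasurableSet {ω | δ < |f ω|} := measurableSet_lt measurable_const (by fun_prop)
  rw [← integral_sub (μ := μ) (integrable_truncAt hf (hδ.trans hl)) (integrable_ite_abs_le hf hδ)]
  have h1 : Integrable ({ω | δ < |f ω|}.indicator fun _ => l) μ :=
    (integrable_const l).indicator hms
  rw [← Real.norm_eq_abs]
  refine (norm_integral_le_of_norm_le h1 (Filter.Eventually.of_forall fun ω => ?_)).trans ?_
  · simpa [Set.indicator_apply] using abs_truncAt_sub_ite_le hδ hl (f ω)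
  · simp [integral_indicator hms, Measure.real, mul_comm]

lemma ofReal_integral_truncAt_sq_le {f : Ω → ℝ} (hf : Measurable f) {δ l : ℝ}
    (hδ : 0 ≤ δ) (hl : δ ≤ l) :
    ENNReal.ofReal (∫ ω, (truncAt l (f ω) - ∫ ω', truncAt l (f ω') ∂μ) ^ 2 ∂μ)
      ≤ 2 * ENNReal.ofReal
          (ProbabilityTheory.variance (fun ω => if |f ω| ≤ δ then f ω else 0) μ)
        + 2 * ENNReal.ofReal l *
          ∫⁻ ω, ENNReal.ofReal (if δ < |f ω| then |f ω| else 0) ∂μ := by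
  have hl0 := hδ.trans hl
  have hg : Measurable fun ω => truncAt l (f ω) := (measurable_truncAt l).comp hf
  have hY := measurable_ite_abs_le hf δ
  set m := ∫ ω, (if |f ω| ≤ δ then f ω else 0) ∂μ with hm
  have hYi : Integrable (fun ω => ((if |f ω| ≤ δ then f ω else 0) - m) ^ 2) μ := by
    refine Integrable.of_bound (by fun_prop) ((δ + |m|) ^ 2)
      (Filter.Eventually.of_forall fun ω => ?_)
    rw [norm_pow]
    exact pow_le_pow_left₀ (norm_nonneg _)
      ((abs_sub _ _).trans (add_le_add (abs_ite_abs_le hδ _) le_rfl)) 2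
  have hZi : Integrable (fun ω => (truncAt l (f ω) - if |f ω| ≤ δ then f ω else 0) ^ 2) μ := by
    refine Integrable.of_bound (by fun_prop) ((l + δ) ^ 2)
      (Filter.Eventually.of_forall fun ω => ?_)
    rw [norm_pow]
    exact pow_le_pow_left₀ (norm_nonneg _)
      ((abs_sub _ _).trans (add_le_add (abs_truncAt_le hl0 _) (abs_ite_abs_le hδ _))) 2
  have h1 : ∫ ω, (truncAt l (f ω) - ∫ ω', truncAt l (f ω') ∂μ) ^ 2 ∂μ
      ≤ 2 * ProbabilityTheory.variance (fun ω => if |f ω| ≤ δ then f ω else 0) μ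
        + 2 * ∫ ω, (truncAt l (f ω) - if |f ω| ≤ δ then f ω else 0) ^ 2 ∂μ := by
    rw [← ProbabilityTheory.variance_eq_integral hg.aemeasurable,
      ← ProbabilityTheory.variance_sub_const hg.aestronglyMeasurable m,
      ProbabilityTheory.variance_eq_integral hY.aemeasurable, ← hm,
      ← integral_const_mul, ← integral_const_mul,
      ← integral_add (hYi.const_mul 2) (hZi.const_mul 2)]
    refine (ProbabilityTheory.variance_le_expectation_sq
      (hg.sub_const m).aestronglyMeasurable).trans ?_
    refine integral_mono_of_nonneg (Filter.Eventually.of_forall fun ω => sq_nonneg _)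
      ((hYi.const_mul 2).add (hZi.const_mul 2)) (Filter.Eventually.of_forall fun ω => ?_)
    simp only [Pi.pow_apply]
    generalize (if |f ω| ≤ δ then f ω else 0) = y
    nlinarith [sq_nonneg ((y - m) - (truncAt l (f ω) - y))]
  refine (ENNReal.ofReal_le_ofReal h1).trans ?_
  rw [ENNReal.ofReal_add (mul_nonneg zero_le_two (ProbabilityTheory.variance_nonneg _ _))
    (mul_nonneg zero_le_two (integral_nonneg fun ω => sq_nonneg _)),
    ENNReal.ofReal_mul zero_le_two, ENNReal.ofReal_mul zero_le_two, ENNReal.ofReal_ofNat,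
    ofReal_integral_eq_lintegral_ofReal hZi (Filter.Eventually.of_forall fun ω => sq_nonneg _),
    mul_assoc 2 (ENNReal.ofReal l), ← lintegral_const_mul' _ _ ENNReal.ofReal_ne_top]
  gcongr with ω
  rw [← ENNReal.ofReal_mul hl0]
  exact ENNReal.ofReal_le_ofReal (sq_truncAt_sub_ite_le hδ hl _)

lemma abs_sum_sub_le_of_abs_le {K : ℕ} {Y : ℕ → Ω → ℝ}
    (hY : ∀ j ∈ Finset.Icc 1 K, Measurable (Y j)) {δ l M : ℝ} (hδ : 0 ≤ δ) (hl : δ ≤ l)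
    (hM : ∑ j ∈ Finset.Icc 1 K, (μ {ω | δ < |Y j ω|}).toReal ≤ M) {ω : Ω}
    (hω : ∀ j ∈ Finset.Icc 1 K, |Y j ω| ≤ l) {i : ℕ} (hi : i ∈ Finset.Icc 1 K) :
    |∑ j ∈ Finset.Icc 1 i, (Y j ω - ∫ ω', (if |Y j ω'| ≤ δ then Y j ω' else 0) ∂μ)|
      ≤ |∑ j ∈ Finset.Icc 1 i, (truncAt l (Y j ω) - ∫ ω', truncAt l (Y j ω') ∂μ)| + l * M := by
  have hsub : Finset.Icc 1 i ⊆ Finset.Icc 1 K :=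
    Finset.Icc_subset_Icc_right (Finset.mem_Icc.1 hi).2
  have hsplit : ∑ j ∈ Finset.Icc 1 i, (Y j ω - ∫ ω', (if |Y j ω'| ≤ δ then Y j ω' else 0) ∂μ)
      = ∑ j ∈ Finset.Icc 1 i, (truncAt l (Y j ω) - ∫ ω', truncAt l (Y j ω') ∂μ)
        + ∑ j ∈ Finset.Icc 1 i, (∫ ω', truncAt l (Y j ω') ∂μ
          - ∫ ω', (if |Y j ω'| ≤ δ then Y j ω' else 0) ∂μ) := by
    rw [← Finset.sum_add_distrib]
    refine Finset.sum_congr rfl fun j hj => ?_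
    rw [truncAt_of_abs_le (hω j (hsub hj))]
    ring
  rw [hsplit]
  refine (abs_add_le _ _).trans (add_le_add le_rfl ?_)
  calc _ ≤ ∑ j ∈ Finset.Icc 1 i, |∫ ω', truncAt l (Y j ω') ∂μ
          - ∫ ω', (if |Y j ω'| ≤ δ then Y j ω' else 0) ∂μ| := Finset.abs_sum_le_sum_abs _ _
    _ ≤ ∑ j ∈ Finset.Icc 1 i, l * (μ {ω | δ < |Y j ω|}).toReal :=
        Finset.sum_le_sum fun j hj => abs_integral_truncAt_sub_le (hY j (hsub hj)) hδ hl
    _ ≤ ∑ j ∈ Finset.Icc 1 K, l * (μ {ω | δ < |Y j ω|}).toReal :=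
        Finset.sum_le_sum_of_subset_of_nonneg hsub fun j _ _ =>
          mul_nonneg (hδ.trans hl) ENNReal.toReal_nonneg
    _ ≤ l * M := by
        rw [← Finset.mul_sum]
        exact mul_le_mul_of_nonneg_left hM (hδ.trans hl)

lemma measure_lt_max_sum_le {K : ℕ} {Y : ℕ → Ω → ℝ}
    (hY : ∀ j ∈ Finset.Icc 1 K, Measurable (Y j)) {δ M a q s b C₁ C₂ : ℝ} {A : ENNReal}
    (hδ : 0 < δ) (hq : 0 < q) (hC₂ : 0 < C₂) (ha : 0 < a) (hs : 0 < s)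
    (hM : ∑ j ∈ Finset.Icc 1 K, (μ {ω | δ < |Y j ω|}).toReal ≤ M)
    (haM : a * M ≤ 1 / 2) (haC : 2 * a ≤ C₁ / (2 * q)) (has : δ ≤ a * s)
    (hineq : ∀ l > (0 : ℝ), ∀ lam > (0 : ℝ), ∀ η > (0 : ℝ),
      μ {ω | ∃ i ∈ Finset.Icc 1 K, lam ≤
          |∑ j ∈ Finset.Icc 1 i, (truncAt l (Y j ω) - ∫ ω', truncAt l (Y j ω') ∂μ)|}
        ≤ A * μ {ω | ∃ j ∈ Finset.Icc 1 K,
              C₁ * η < |truncAt l (Y j ω) - ∫ ω', truncAt l (Y j ω') ∂μ|}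
          + ENNReal.ofReal b *
            ENNReal.ofReal ((∑ j ∈ Finset.Icc 1 K,
                ∫ ω', (truncAt l (Y j ω') - ∫ ω'', truncAt l (Y j ω'') ∂μ) ^ 2 ∂μ) /
              (C₂ * lam * η)) ^ (lam / η)) :
    μ {ω | ∃ i ∈ Finset.Icc 1 K, s < |∑ j ∈ Finset.Icc 1 i,
        (Y j ω - ∫ ω', (if |Y j ω'| ≤ δ then Y j ω' else 0) ∂μ)|}
      ≤ ∑ j ∈ Finset.Icc 1 K, μ {ω | a * s < |Y j ω|}
        + ENNReal.ofReal b * (ENNReal.ofReal ((8 * q * a / (C₂ * δ) + 8 * q * a / C₂) / s) *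
          (∑ j ∈ Finset.Icc 1 K, ENNReal.ofReal
              (ProbabilityTheory.variance (fun ω => if |Y j ω| ≤ δ then Y j ω else 0) μ)
            + ∑ j ∈ Finset.Icc 1 K,
              ∫⁻ ω, ENNReal.ofReal (if δ < |Y j ω| then |Y j ω| else 0) ∂μ)) ^ q := by
  have hl : 0 < a * s := mul_pos ha hs
  have hη : 0 < s / (2 * q) := by positivity
  have key := hineq (a * s) hl (s / 2) (by positivity) (s / (2 * q)) hη
  have hempty : {ω | ∃ j ∈ Finset.Icc 1 K, C₁ * (s / (2 * q)) <
      |truncAt (a * s) (Y j ω) - ∫ ω', truncAt (a * s) (Y j ω') ∂μ|} = ∅ := by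
    refine Set.eq_empty_of_forall_notMem fun ω hω => ?_
    obtain ⟨j, -, hj⟩ := hω
    have h1 : |truncAt (a * s) (Y j ω) - ∫ ω', truncAt (a * s) (Y j ω') ∂μ| ≤ a * s + a * s :=
      (abs_sub _ _).trans (add_le_add (abs_truncAt_le hl.le _) (abs_integral_truncAt_le hl.le))
    have h2 : C₁ * (s / (2 * q)) = C₁ / (2 * q) * s := by ring
    nlinarith [mul_le_mul_of_nonneg_right haC hs.le]
  have hratio : s / 2 / (s / (2 * q)) = q := by field_simp
  rw [hempty, measure_empty, mul_zero, zero_add, hratio] at key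
  have hcover : {ω | ∃ i ∈ Finset.Icc 1 K, s < |∑ j ∈ Finset.Icc 1 i,
        (Y j ω - ∫ ω', (if |Y j ω'| ≤ δ then Y j ω' else 0) ∂μ)|}
      ⊆ (⋃ j ∈ Finset.Icc 1 K, {ω | a * s < |Y j ω|}) ∪
        {ω | ∃ i ∈ Finset.Icc 1 K, s / 2 ≤ |∑ j ∈ Finset.Icc 1 i,
          (truncAt (a * s) (Y j ω) - ∫ ω', truncAt (a * s) (Y j ω') ∂μ)|} := by
    rintro ω ⟨i, hi, hlt⟩
    by_cases hω : ∀ j ∈ Finset.Icc 1 K, |Y j ω| ≤ a * s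
    · refine Or.inr ⟨i, hi, ?_⟩
      have := abs_sum_sub_le_of_abs_le hY hδ.le has hM hω hi
      nlinarith [mul_le_mul_of_nonneg_right haM hs.le]
    · push Not at hω
      obtain ⟨j, hj, hjl⟩ := hω
      exact Or.inl (Set.mem_biUnion hj hjl)
  refine (measure_mono hcover).trans ((measure_union_le _ _).trans ?_)
  refine add_le_add (measure_biUnion_finset_le _ _) (key.trans ?_)
  gcongr
  set V := ∑ j ∈ Finset.Icc 1 K, ENNReal.ofReal
    (ProbabilityTheory.variance (fun ω => if |Y j ω| ≤ δ then Y j ω else 0) μ)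
  set D := ∑ j ∈ Finset.Icc 1 K,
    ∫⁻ ω, ENNReal.ofReal (if δ < |Y j ω| then |Y j ω| else 0) ∂μ
  have hκ : 0 ≤ 4 * q / (C₂ * s ^ 2) := by positivity
  calc _ = ENNReal.ofReal (4 * q / (C₂ * s ^ 2)) * ENNReal.ofReal (∑ j ∈ Finset.Icc 1 K,
        ∫ ω', (truncAt (a * s) (Y j ω') - ∫ ω'', truncAt (a * s) (Y j ω'') ∂μ) ^ 2 ∂μ) := by
        rw [← ENNReal.ofReal_mul hκ]
        congr 1
        field_simp
        ring
    _ ≤ ENNReal.ofReal (4 * q / (C₂ * s ^ 2)) * (2 * V + 2 * ENNReal.ofReal (a * s) * D) := by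
        gcongr
        rw [ENNReal.ofReal_sum_of_nonneg fun j _ => integral_nonneg fun ω => sq_nonneg _,
          Finset.mul_sum, Finset.mul_sum, ← Finset.sum_add_distrib]
        exact Finset.sum_le_sum fun j hj => ofReal_integral_truncAt_sq_le (hY j hj) hδ.le has
    _ = ENNReal.ofReal (8 * q / (C₂ * s ^ 2)) * V
        + ENNReal.ofReal (8 * q * a / C₂ / s) * D := by
        have e1 : 8 * q / (C₂ * s ^ 2) = 4 * q / (C₂ * s ^ 2) * 2 := by ring
        have e2 : 8 * q * a / C₂ / s = 4 * q / (C₂ * s ^ 2) * 2 * (a * s) := by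
          field_simp
          ring
        rw [e1, e2, ENNReal.ofReal_mul (q := a * s) (by positivity),
          ENNReal.ofReal_mul (q := 2) hκ, ENNReal.ofReal_ofNat]
        ring
    _ ≤ _ := by
        rw [mul_add]
        gcongr ENNReal.ofReal ?_ * V + ENNReal.ofReal ?_ * D
        · calc 8 * q / (C₂ * s ^ 2) = 8 * q / (C₂ * δ) / s * (δ / s) := by field_simp
            _ ≤ 8 * q / (C₂ * δ) / s * a := by
              gcongr
              exact (div_le_iff₀ hs).2 has
            _ = 8 * q * a / (C₂ * δ) / s := by ring
            _ ≤ _ := by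
              gcongr
              exact le_add_of_nonneg_right (by positivity)
        · gcongr
          exact le_add_of_nonneg_left (by positivity)

lemma lintegral_Ioi_measure_lt_max_sum_le {K : ℕ} {Y : ℕ → Ω → ℝ}
    (hY : ∀ j ∈ Finset.Icc 1 K, Measurable (Y j)) {δ M a p q b C₁ C₂ : ℝ} {A : ENNReal}
    (hp : 0 < p) (hδ : 0 < δ) (hq : 1 ≤ q) (hC₂ : 0 < C₂) (ha : 0 < a)
    (hM : ∑ j ∈ Finset.Icc 1 K, (μ {ω | δ < |Y j ω|}).toReal ≤ M)
    (haM : a * M ≤ 1 / 2) (haC : 2 * a ≤ C₁ / (2 * q))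
    (hineq : ∀ l > (0 : ℝ), ∀ lam > (0 : ℝ), ∀ η > (0 : ℝ),
      μ {ω | ∃ i ∈ Finset.Icc 1 K, lam ≤
          |∑ j ∈ Finset.Icc 1 i, (truncAt l (Y j ω) - ∫ ω', truncAt l (Y j ω') ∂μ)|}
        ≤ A * μ {ω | ∃ j ∈ Finset.Icc 1 K,
              C₁ * η < |truncAt l (Y j ω) - ∫ ω', truncAt l (Y j ω') ∂μ|}
          + ENNReal.ofReal b *
            ENNReal.ofReal ((∑ j ∈ Finset.Icc 1 K,
                ∫ ω', (truncAt l (Y j ω') - ∫ ω'', truncAt l (Y j ω'') ∂μ) ^ 2 ∂μ) /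
              (C₂ * lam * η)) ^ (lam / η)) :
    ∫⁻ t in Set.Ioi ((δ / a) ^ p), μ {ω | ∃ i ∈ Finset.Icc 1 K, t ^ p⁻¹ <
        |∑ j ∈ Finset.Icc 1 i, (Y j ω - ∫ ω', (if |Y j ω'| ≤ δ then Y j ω' else 0) ∂μ)|}
      ≤ ENNReal.ofReal ((a ^ p)⁻¹) *
          (∑ j ∈ Finset.Icc 1 K, ∫⁻ t in Set.Ioi (δ ^ p), μ {ω | t < |Y j ω| ^ p})
        + (∫⁻ t in Set.Ioi ((δ / a) ^ p), ENNReal.ofReal (t ^ (-(q / p)))) *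
          ENNReal.ofReal (8 * q * a / (C₂ * δ) + 8 * q * a / C₂) ^ q * 2 ^ (q - 1) *
          (ENNReal.ofReal b * ENNReal.ofReal ((∑ j ∈ Finset.Icc 1 K,
              ProbabilityTheory.variance (fun ω => if |Y j ω| ≤ δ then Y j ω else 0) μ) ^ q)
            + ENNReal.ofReal b * (∑ j ∈ Finset.Icc 1 K,
              ∫⁻ ω, ENNReal.ofReal (if δ < |Y j ω| then |Y j ω| else 0) ∂μ) ^ q) := by
  have hq0 : 0 < q := one_pos.trans_le hq
  set κ := 8 * q * a / (C₂ * δ) + 8 * q * a / C₂ with hκ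
  have hκ0 : 0 ≤ κ := by positivity
  have hT : 0 < (δ / a) ^ p := by positivity
  have hap : 0 < a ^ p := by positivity
  rw [← ENNReal.ofReal_rpow_of_nonneg
    (Finset.sum_nonneg fun j _ => ProbabilityTheory.variance_nonneg _ _) hq0.le,
    ENNReal.ofReal_sum_of_nonneg fun j _ => ProbabilityTheory.variance_nonneg _ _]
  set V := ∑ j ∈ Finset.Icc 1 K, ENNReal.ofReal
    (ProbabilityTheory.variance (fun ω => if |Y j ω| ≤ δ then Y j ω else 0) μ) with hV
  set D := ∑ j ∈ Finset.Icc 1 K,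
    ∫⁻ ω, ENNReal.ofReal (if δ < |Y j ω| then |Y j ω| else 0) ∂μ with hD
  have hmeas : ∀ j ∈ Finset.Icc 1 K, Measurable fun t : ℝ => μ {ω | a ^ p * t < |Y j ω| ^ p} :=
    fun j _ => (antitone_measure_lt_abs_rpow (μ := μ) (Y j) p).measurable.comp
      (measurable_const_mul _)
  have hpt : ∀ t ∈ Set.Ioi ((δ / a) ^ p), μ {ω | ∃ i ∈ Finset.Icc 1 K, t ^ p⁻¹ <
        |∑ j ∈ Finset.Icc 1 i, (Y j ω - ∫ ω', (if |Y j ω'| ≤ δ then Y j ω' else 0) ∂μ)|}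
      ≤ ∑ j ∈ Finset.Icc 1 K, μ {ω | a ^ p * t < |Y j ω| ^ p}
        + ENNReal.ofReal (t ^ (-(q / p))) * (ENNReal.ofReal b *
          (ENNReal.ofReal κ ^ q * (V + D) ^ q)) := by
    intro t ht
    have ht0 : 0 < t := hT.trans ht
    have hs : 0 < t ^ p⁻¹ := by positivity
    have has : δ ≤ a * t ^ p⁻¹ := by
      rw [mul_comm, ← div_le_iff₀ ha, Real.le_rpow_inv_iff_of_pos (by positivity) ht0.le hp]
      exact (Set.mem_Ioi.1 ht).le
    refine (measure_lt_max_sum_le hY hδ hq0 hC₂ ha hs hM haM haC has hineq).trans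
      (add_le_add (Finset.sum_le_sum fun j _ => measure_mono fun ω hω => ?_) (le_of_eq ?_))
    · have := Real.rpow_lt_rpow (by positivity) hω hp
      rwa [Real.mul_rpow ha.le hs.le, Real.rpow_inv_rpow ht0.le hp.ne'] at this
    · rw [ENNReal.mul_rpow_of_nonneg _ _ hq0.le, div_eq_mul_inv, ENNReal.ofReal_mul hκ0,
        ENNReal.mul_rpow_of_nonneg _ _ hq0.le,
        ENNReal.ofReal_rpow_of_nonneg (inv_nonneg.2 hs.le) hq0.le,
        ← Real.rpow_neg ht0.le, ← Real.rpow_mul ht0.le,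
        show -p⁻¹ * q = -(q / p) by ring]
      ring
  refine (setLIntegral_mono' measurableSet_Ioi hpt).trans ?_
  rw [lintegral_add_left (Finset.measurable_fun_sum _ hmeas), lintegral_finsetSum _ hmeas,
    lintegral_mul_const _ (by fun_prop), Finset.mul_sum]
  refine add_le_add (Finset.sum_le_sum fun j _ => le_of_eq ?_) ?_
  · have h := lintegral_Ioi_comp_mul_left (fun t => μ {ω | t < |Y j ω| ^ p}) hap ((δ / a) ^ p)
    rw [← Real.mul_rpow ha.le (by positivity), mul_div_cancel₀ _ ha.ne'] at h
    rw [← h, ← mul_assoc, ← ENNReal.ofReal_mul (inv_nonneg.2 hap.le), inv_mul_cancel₀ hap.ne',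
      ENNReal.ofReal_one, one_mul]
  · calc _ ≤ (∫⁻ t in Set.Ioi ((δ / a) ^ p), ENNReal.ofReal (t ^ (-(q / p)))) *
          (ENNReal.ofReal b * (ENNReal.ofReal κ ^ q * (2 ^ (q - 1) * (V ^ q + D ^ q)))) := by
          gcongr
          exact ENNReal.rpow_add_le_mul_rpow_add_rpow _ _ hq
      _ = _ := by ring

lemma memLp_of_lintegral_Ioi_measure_lt_top {f : Ω → ℝ} (hf : Measurable f) {p T : ℝ}
    (hp : 0 < p) (hT : 0 ≤ T) (h : ∫⁻ t in Set.Ioi T, μ {ω | t < |f ω| ^ p} < ⊤) :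
    MemLp f (ENNReal.ofReal p) μ := by
  refine ⟨hf.aestronglyMeasurable, ?_⟩
  rw [eLpNorm_lt_top_iff_lintegral_rpow_enorm_lt_top (by simpa using hp) ENNReal.ofReal_ne_top,
    ENNReal.toReal_ofReal hp.le]
  have h1 : ∀ ω, ‖f ω‖ₑ ^ p = ENNReal.ofReal (|f ω| ^ p) := fun ω => by
    rw [Real.enorm_eq_ofReal_abs, ENNReal.ofReal_rpow_of_nonneg (abs_nonneg _) hp.le]
  simp_rw [h1]
  rw [lintegral_eq_lintegral_meas_lt μ
    (Filter.Eventually.of_forall fun ω => Real.rpow_nonneg (abs_nonneg _) _) (by fun_prop),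
    ← Set.Ioc_union_Ioi_eq_Ioi hT, lintegral_union measurableSet_Ioi
      (Set.Ioc_disjoint_Ioi le_rfl)]
  refine ENNReal.add_lt_top.2 ⟨?_, h⟩
  calc _ ≤ ∫⁻ _ in Set.Ioc 0 T, (1 : ENNReal) := lintegral_mono fun t => prob_le_one
    _ < ⊤ := by simp

lemma iSup_mem_le_of_forall_le {s : Finset ℕ} {f : ℕ → ℝ} {C : ℝ} (hC : 0 ≤ C)
    (h : ∀ i ∈ s, f i ≤ C) : ⨆ i ∈ s, f i ≤ C :=
  Real.iSup_le (fun i => Real.iSup_le (h i) hC) hC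

lemma lintegral_max_sum_rpow_lt_top {K : ℕ} {Y : ℕ → Ω → ℝ} {p ε : ℝ} (hp : 0 < p) (hε : 0 < ε)
    (hY : ∀ j ∈ Finset.Icc 1 K, MemLp (Y j) (ENNReal.ofReal p) μ) (m : ℕ → ℝ) :
    ∫⁻ ω, ENNReal.ofReal ((⨆ i ∈ Finset.Icc 1 K,
      |∑ j ∈ Finset.Icc 1 i, (Y j ω - m j)|) - ε) ^ p ∂μ < ⊤ := by
  have hG : MemLp (fun ω => ∑ j ∈ Finset.Icc 1 K, |Y j ω - m j|) (ENNReal.ofReal p) μ :=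
    memLp_finsetSum _ fun j hj => ((hY j hj).sub (memLp_const (m j))).abs
  have hG' := lintegral_rpow_enorm_lt_top_of_eLpNorm_lt_top (by simpa using hp)
    ENNReal.ofReal_ne_top hG.2
  rw [ENNReal.toReal_ofReal hp.le] at hG'
  refine (lintegral_mono fun ω => ?_).trans_lt hG'
  have h0 : 0 ≤ ∑ j ∈ Finset.Icc 1 K, |Y j ω - m j| := Finset.sum_nonneg fun _ _ => abs_nonneg _
  rw [Real.enorm_eq_ofReal h0]
  gcongr
  refine (sub_le_self _ hε.le).trans (iSup_mem_le_of_forall_le h0 fun i hi => ?_)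
  exact (Finset.abs_sum_le_sum_abs _ _).trans (Finset.sum_le_sum_of_subset_of_nonneg
    (Finset.Icc_subset_Icc_right (Finset.mem_Icc.1 hi).2) fun _ _ _ => abs_nonneg _)

lemma measurable_iSup_abs_sum {K : ℕ} {Y : ℕ → Ω → ℝ}
    (hY : ∀ j ∈ Finset.Icc 1 K, Measurable (Y j)) (m : ℕ → ℝ) :
    Measurable fun ω => ⨆ i ∈ Finset.Icc 1 K, |∑ j ∈ Finset.Icc 1 i, (Y j ω - m j)| := by
  refine Measurable.iSup fun i => Measurable.iSup fun hi => ?_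
  have : Measurable fun ω => ∑ j ∈ Finset.Icc 1 i, (Y j ω - m j) :=
    Finset.measurable_fun_sum _ fun j hj => (hY j
      (Finset.Icc_subset_Icc_right (Finset.mem_Icc.1 hi).2 hj)).sub_const _
  fun_prop

end Row

lemma tsum_lt_top_of_eventually_le {f g : ℕ → ENNReal} (hf : ∀ n, f n < ⊤)
    (hfg : ∀ᶠ n in Filter.atTop, f n ≤ g n) (hg : ∑' n, g n < ⊤) : ∑' n, f n < ⊤ := by
  obtain ⟨N, hN⟩ := Filter.eventually_atTop.1 hfg
  rw [← Summable.sum_add_tsum_nat_add' (f := f) (k := N) ENNReal.summable]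
  refine ENNReal.add_lt_top.2 ⟨ENNReal.sum_lt_top.2 fun n _ => hf n, ?_⟩
  refine (ENNReal.tsum_le_tsum fun n => hN (n + N) (Nat.le_add_left N n)).trans_lt ?_
  exact (ENNReal.tsum_comp_le_tsum_of_injective (add_left_injective N) g).trans_lt hg

/-- Theorem 3: convergence of the series of moments
`∑ cₙ E (max_{1≤i≤kₙ} |∑_{j=1}^i (X_{n,j} − E X_{n,j} 1_{|X_{n,j}|≤δ})| − ε)₊^p`. -/
theorem theorem3 {Ω : Type*} [MeasurableSpace Ω] (μ : Measure Ω) [IsProbabilityMeasure μ]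
    (p : ℝ) (hp : 1 ≤ p)
    (k : ℕ → ℕ) (hk1 : ∀ n, 1 ≤ k n) (hk : Filter.Tendsto k Filter.atTop Filter.atTop)
    (X : ℕ → ℕ → Ω → ℝ) (hmeas : ∀ n j, j ∈ Finset.Icc 1 (k n) → Measurable (X n j))
    (c α β : ℕ → ℝ) (hc : ∀ n, 0 < c n) (hα : ∀ n, 0 ≤ α n) (hβ : ∀ n, 0 ≤ β n)
    (hineq : ExpMaxIneq μ k X α β)
    (δ : ℝ) (hδ : 0 < δ)
    -- (a)
    (ha : ∀ lam > (0 : ℝ),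
      (∑' n, ENNReal.ofReal (c n) *
        μ {ω | ∃ i ∈ Finset.Icc 1 (k n), lam <
          |∑ j ∈ Finset.Icc 1 i,
            (X n j ω - ∫ ω', (if |X n j ω'| ≤ δ then X n j ω' else 0) ∂μ)|}) < ⊤)
    -- (b)
    (hb₁ : Filter.Tendsto
      (fun n => (Finset.Icc 1 (k n)).sup (fun j => μ {ω | δ < |X n j ω|}))
      Filter.atTop (nhds 0))
    (hb₂ : ∃ M : ENNReal, M ≠ ⊤ ∧ ∀ᶠ n in Filter.atTop,
      ∑ j ∈ Finset.Icc 1 (k n), μ {ω | δ < |X n j ω|} ≤ M)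
    -- (c)
    (hcc : (∑' n, ∑ j ∈ Finset.Icc 1 (k n), ENNReal.ofReal (c n * (1 + α n)) *
        ∫⁻ t in Set.Ioi (δ ^ p), μ {ω | t < |X n j ω| ^ p}) < ⊤)
    -- (d)
    (q : ℝ) (hq : p < q)
    (hd₁ : (∑' n, ENNReal.ofReal (c n * β n) *
        ∫⁻ t in Set.Ioi (δ ^ p),
          (∑ j ∈ Finset.Icc 1 (k n), μ {ω | t < |X n j ω| ^ p}) ^ q) < ⊤)
    (hd₂ : (∑' n, ENNReal.ofReal (c n * β n) *
        ENNReal.ofReal ((∑ j ∈ Finset.Icc 1 (k n),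
          ProbabilityTheory.variance (fun ω => if |X n j ω| ≤ δ then X n j ω else 0) μ) ^ q))
      < ⊤)
    (hd₃ : (∑' n, ENNReal.ofReal (c n * β n) *
        (∑ j ∈ Finset.Icc 1 (k n),
          ∫⁻ ω, ENNReal.ofReal (if δ < |X n j ω| then |X n j ω| else 0) ∂μ) ^ q) < ⊤) :
    ∀ ε > (0 : ℝ),
      (∑' n, ENNReal.ofReal (c n) *
        ∫⁻ ω, (ENNReal.ofReal
          ((⨆ i ∈ Finset.Icc 1 (k n),
            |∑ j ∈ Finset.Icc 1 i,
              (X n j ω - ∫ ω', (if |X n j ω'| ≤ δ then X n j ω' else 0) ∂μ)|) - ε)) ^ p ∂μ)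
      < ⊤ := by
  intro ε hε
  obtain ⟨C₁, hC₁, C₂, hC₂, hineq⟩ := hineq
  obtain ⟨M, hM, hMn⟩ := hb₂
  have hp0 : 0 < p := one_pos.trans_le hp
  have hq1 : 1 ≤ q := hp.trans hq.le
  have hq0 : 0 < q := one_pos.trans_le hq1
  have hM0 : 0 ≤ M.toReal := ENNReal.toReal_nonneg
  obtain ⟨a, ha0, haM, haC⟩ : ∃ a > 0, a * M.toReal ≤ 1 / 2 ∧ 2 * a ≤ C₁ / (2 * q) := by
    refine ⟨min (1 / (2 * (M.toReal + 1))) (C₁ / (4 * q)), by positivity, ?_, ?_⟩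
    · calc _ ≤ 1 / (2 * (M.toReal + 1)) * (M.toReal + 1) :=
            mul_le_mul (min_le_left _ _) (by linarith) hM0 (by positivity)
        _ = 1 / 2 := by field_simp
    · calc _ ≤ 2 * (C₁ / (4 * q)) := by gcongr; exact min_le_right _ _
        _ = C₁ / (2 * q) := by ring
  set T := (δ / a) ^ p with hTdef
  have hT : 0 < T := by positivity
  set J := (∫⁻ t in Set.Ioi T, ENNReal.ofReal (t ^ (-(q / p)))) *
    ENNReal.ofReal (8 * q * a / (C₂ * δ) + 8 * q * a / C₂) ^ q * 2 ^ (q - 1) with hJdef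
  have hJ : J ≠ ⊤ := by
    refine ENNReal.mul_ne_top (ENNReal.mul_ne_top (Integrable.lintegral_lt_top ?_).ne
      (ENNReal.rpow_ne_top_of_nonneg hq0.le ENNReal.ofReal_ne_top))
      (ENNReal.rpow_ne_top_of_nonneg (by linarith) ENNReal.ofNat_ne_top)
    exact integrableOn_Ioi_rpow_of_lt (neg_lt_neg ((one_lt_div hp0).2 hq)) hT
  have hcα : ∀ n, 0 < c n * (1 + α n) := fun n => mul_pos (hc n) (by linarith [hα n])
  have hLp : ∀ n, ∀ j ∈ Finset.Icc 1 (k n), MemLp (X n j) (ENNReal.ofReal p) μ := by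
    intro n j hj
    refine memLp_of_lintegral_Ioi_measure_lt_top (hmeas n j hj) hp0
      (Real.rpow_nonneg hδ.le p) ?_
    have h1 := ENNReal.sum_lt_top.1 ((ENNReal.le_tsum n).trans_lt hcc) j hj
    exact (ENNReal.lt_top_of_mul_ne_top_right h1.ne (by simpa using hcα n))
  refine tsum_lt_top_of_eventually_le
    (fun n => ENNReal.mul_lt_top ENNReal.ofReal_lt_top
      (lintegral_max_sum_rpow_lt_top hp0 hε (hLp n) _))
    (g := fun n => ENNReal.ofReal T * (ENNReal.ofReal (c n) *
        μ {ω | ∃ i ∈ Finset.Icc 1 (k n), ε < |∑ j ∈ Finset.Icc 1 i,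
          (X n j ω - ∫ ω', (if |X n j ω'| ≤ δ then X n j ω' else 0) ∂μ)|})
      + (ENNReal.ofReal ((a ^ p)⁻¹) * (∑ j ∈ Finset.Icc 1 (k n),
          ENNReal.ofReal (c n * (1 + α n)) *
            ∫⁻ t in Set.Ioi (δ ^ p), μ {ω | t < |X n j ω| ^ p})
        + J * (ENNReal.ofReal (c n * β n) * ENNReal.ofReal ((∑ j ∈ Finset.Icc 1 (k n),
            ProbabilityTheory.variance (fun ω => if |X n j ω| ≤ δ then X n j ω else 0) μ) ^ q)
          + ENNReal.ofReal (c n * β n) * (∑ j ∈ Finset.Icc 1 (k n),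
            ∫⁻ ω, ENNReal.ofReal (if δ < |X n j ω| then |X n j ω| else 0) ∂μ) ^ q))) ?_ ?_
  · filter_upwards [hMn, Filter.eventually_ge_atTop 1] with n hn hn1
    have hsum : ∑ j ∈ Finset.Icc 1 (k n), (μ {ω | δ < |X n j ω|}).toReal ≤ M.toReal := by
      rw [← ENNReal.toReal_sum fun j _ => measure_ne_top _ _]
      exact ENNReal.toReal_mono hM hn
    have htail := lintegral_Ioi_measure_lt_max_sum_le (hmeas n) hp0 hδ hq1 hC₂ ha0 hsum haM haC
      (hineq n hn1)
    rw [← hTdef, ← hJdef] at htail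
    have hex : ∀ s : ℝ, 0 ≤ s →
        {ω | s < (⨆ i ∈ Finset.Icc 1 (k n), |∑ j ∈ Finset.Icc 1 i,
          (X n j ω - ∫ ω', (if |X n j ω'| ≤ δ then X n j ω' else 0) ∂μ)|)} ⊆
        {ω | ∃ i ∈ Finset.Icc 1 (k n), s < |∑ j ∈ Finset.Icc 1 i,
          (X n j ω - ∫ ω', (if |X n j ω'| ≤ δ then X n j ω' else 0) ∂μ)|} := by
      intro s hs ω h
      contrapose! h
      simp only [Set.mem_ofPred_eq, not_exists, not_and, not_lt] at h ⊢
      exact iSup_mem_le_of_forall_le hs h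
    have hmom := (lintegral_rpow_sub_le (μ := μ) (measurable_iSup_abs_sum (hmeas n)
      fun j => ∫ ω', (if |X n j ω'| ≤ δ then X n j ω' else 0) ∂μ) hp0 hε hT.le).trans
      (add_le_add (mul_le_mul_right (measure_mono (hex ε hε.le)) _)
        ((setLIntegral_mono' measurableSet_Ioi fun t ht => measure_mono
          (hex (t ^ p⁻¹) (Real.rpow_nonneg (hT.trans ht).le _))).trans htail))
    refine (mul_le_mul_right hmom _).trans ?_
    rw [mul_add, mul_add, ENNReal.ofReal_mul (q := β n) (hc n).le, ← Finset.mul_sum]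
    refine add_le_add (le_of_eq (by ring)) (add_le_add ?_ (le_of_eq (by ring)))
    rw [mul_left_comm]
    gcongr
    exact le_mul_of_one_le_right (hc n).le (by linarith [hα n])
  · simp only [ENNReal.tsum_add, ENNReal.tsum_mul_left]
    exact ENNReal.add_lt_top.2 ⟨ENNReal.mul_lt_top ENNReal.ofReal_lt_top (ha ε hε),
      ENNReal.add_lt_top.2 ⟨ENNReal.mul_lt_top ENNReal.ofReal_lt_top hcc,
        ENNReal.mul_lt_top hJ.lt_top (ENNReal.add_lt_top.2 ⟨hd₂, hd₃⟩)⟩⟩
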